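/- arXiv:2410.06000 — 7 statements merged into one kernel-verified Lean document; each statement's English description precedes it below -/
import Mathlib

section
/- Let μ ∈ ℝ and σ > 0. Then (1/√(2πσ²)) ∫₀^∞ exp(−w²/2 − (w−μ)²/(2σ²)) dw = (1/√(1+σ²)) · exp(−μ²/(2(1+σ²))) · Φ((μ/σ)/√(1+σ²)). -/
open MeasureTheory Real

/-- The standard normal cumulative distribution function. -/
noncomputable def stdNormalCDF (x : ℝ) : ℝ :=
  ∫ z in Set.Iic x, (Real.sqrt (2 * Real.pi))⁻¹ * Real.exp (-z ^ 2 / 2)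

/-- Affine reflection of an improper integral over `(-∞, b]` to one over `(0, ∞)`. -/
theorem integral_Iic_eq_mul_integral_comp_sub_mul (g : ℝ → ℝ) (b : ℝ) {a : ℝ} (ha : 0 < a) :
    ∫ z in Set.Iic b, g z = a * ∫ w in Set.Ioi (0 : ℝ), g (b - a * w) := by
  have him : (fun w : ℝ => b - a * w) '' Set.Ioi 0 = Set.Iio b := by
    ext z
    simp only [Set.mem_image, Set.mem_Ioi, Set.mem_Iio]
    constructor
    · rintro ⟨w, hw, rfl⟩
      linarith [mul_pos ha hw]
    · intro hz
      exact ⟨(b - z) / a, div_pos (sub_pos.2 hz) ha, by field_simp; ring⟩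
  have hinj : Set.InjOn (fun w : ℝ => b - a * w) (Set.Ioi 0) := fun x _ y _ h =>
    mul_left_cancel₀ ha.ne' (sub_right_injective h)
  have hderiv : ∀ x ∈ Set.Ioi (0 : ℝ),
      HasDerivWithinAt (fun w : ℝ => b - a * w) (-a) (Set.Ioi 0) x := fun x _ => by
    simpa using (((hasDerivAt_id x).const_mul a).const_sub b).hasDerivWithinAt
  rw [integral_Iic_eq_integral_Iio, ← him,
    integral_image_eq_integral_abs_deriv_smul measurableSet_Ioi hderiv hinj]
  simp only [abs_neg, abs_of_pos ha, smul_eq_mul]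
  exact integral_const_mul _ _

theorem stmt_0 (μ σ : ℝ) (hσ : 0 < σ) :
    (Real.sqrt (2 * Real.pi * σ ^ 2))⁻¹ *
      ∫ w in Set.Ioi (0 : ℝ), Real.exp (-w ^ 2 / 2 - (w - μ) ^ 2 / (2 * σ ^ 2)) =
    (Real.sqrt (1 + σ ^ 2))⁻¹ * Real.exp (-μ ^ 2 / (2 * (1 + σ ^ 2))) *
      stdNormalCDF ((μ / σ) / Real.sqrt (1 + σ ^ 2)) := by
  have hs : 0 < Real.sqrt (1 + σ ^ 2) := by positivity
  have hs2 : Real.sqrt (1 + σ ^ 2) ^ 2 = 1 + σ ^ 2 := Real.sq_sqrt (by positivity)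
  rw [Real.sqrt_mul (by positivity), Real.sqrt_sq hσ.le, stdNormalCDF, integral_const_mul,
    integral_Iic_eq_mul_integral_comp_sub_mul _ _ (div_pos hs hσ)]
  have hp : 0 < Real.sqrt (2 * Real.pi) := by positivity
  generalize Real.sqrt (1 + σ ^ 2) = s at *
  generalize Real.sqrt (2 * Real.pi) = p at *
  rw [← hs2]
  have hsq (w : ℝ) : Real.exp (-w ^ 2 / 2 - (w - μ) ^ 2 / (2 * σ ^ 2)) =
      Real.exp (-μ ^ 2 / (2 * s ^ 2)) * Real.exp (-(μ / σ / s - s / σ * w) ^ 2 / 2) := by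
    rw [← Real.exp_add]
    congr 1
    field_simp
    have hσ2 : σ ^ 2 = s ^ 2 - 1 := by linarith
    ring_nf
    simp only [hσ2]
    ring
  simp_rw [hsq, integral_const_mul]
  field_simp
end

section
/- Let R and W be independent real random variables, where R has the Rayleigh distribution with parameter σ_r > 0 and W is normally distributed with mean μ ∈ ℝ and variance σ_w² > 0. Set μ̃ = μ/σ_w and σ̃ = σ_r/σ_w. Then P(R < W) = Φ(μ̃) − (σ̃/√(1+σ̃²)) · Φ(μ̃ σ̃/√(1+σ̃²)) · exp(−μ̃²/(2(1+σ̃²))). -/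
open MeasureTheory ProbabilityTheory Real

/-- The Rayleigh distribution with parameter `σ`, given by the density
`s/σ² · exp(-s²/(2σ²))` on `(0, ∞)`. -/
noncomputable def rayleighMeasure (σ : ℝ) : Measure ℝ :=
  volume.withDensity fun s =>
    ENNReal.ofReal (if 0 < s then s / σ ^ 2 * Real.exp (-s ^ 2 / (2 * σ ^ 2)) else 0)

/-- A Gaussian variable of mean `m` and standard deviation `s` is positive with probability
`Φ (m / s)`. -/
lemma gaussianReal_real_Ioi_zero (m s : ℝ) (hs : 0 < s) :
    (gaussianReal m (.mk (s ^ 2) (sq_nonneg s))).real (Set.Ioi 0) = stdNormalCDF (m / s) := by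
  have hmap : gaussianReal m (.mk (s ^ 2) (sq_nonneg s)) =
      (gaussianReal 0 1).map (fun z ↦ m - s * z) := by
    have h := Measure.map_map (μ := gaussianReal 0 1) (g := fun x : ℝ ↦ m - x)
      (f := fun z : ℝ ↦ s * z) (by fun_prop) (by fun_prop)
    rw [gaussianReal_map_const_mul, gaussianReal_map_const_sub] at h
    simpa [Function.comp_def] using h
  have hpre : (fun z ↦ m - s * z) ⁻¹' Set.Ioi 0 = Set.Iio (m / s) := by
    ext z
    simp only [Set.mem_preimage, Set.mem_Ioi, Set.mem_Iio, lt_div_iff₀ hs, mul_comm s z, sub_pos]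
  rw [hmap, map_measureReal_apply (by fun_prop) measurableSet_Ioi, hpre, Measure.real,
    gaussianReal_apply_eq_integral 0 one_ne_zero,
    ENNReal.toReal_ofReal (integral_nonneg fun _ ↦ gaussianPDFReal_nonneg _ _ _),
    stdNormalCDF, integral_Iic_eq_integral_Iio]
  simp [gaussianPDFReal]

lemma rayleighMeasure_Iio_of_nonneg {σ w : ℝ} (hσ : 0 < σ) (hw : 0 ≤ w) :
    rayleighMeasure σ (Set.Iio w) = ENNReal.ofReal (1 - exp (-w ^ 2 / (2 * σ ^ 2))) := by
  have hderiv (x : ℝ) : HasDerivAt (fun s ↦ -exp (-s ^ 2 / (2 * σ ^ 2)))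
      (x / σ ^ 2 * exp (-x ^ 2 / (2 * σ ^ 2))) x := by
    refine ((hasDerivAt_pow 2 x).fun_neg.div_const (2 * σ ^ 2)).exp.fun_neg.congr_deriv ?_
    field_simp
    simp [mul_comm]
  have hcont : Continuous fun s : ℝ ↦ s / σ ^ 2 * exp (-s ^ 2 / (2 * σ ^ 2)) := by fun_prop
  have hint : ∫ s in (0 : ℝ)..w, s / σ ^ 2 * exp (-s ^ 2 / (2 * σ ^ 2)) =
      1 - exp (-w ^ 2 / (2 * σ ^ 2)) := by
    rw [intervalIntegral.integral_eq_sub_of_hasDerivAt (fun x _ ↦ hderiv x)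
      (hcont.intervalIntegrable 0 w)]
    simp
    ring
  have hind : (Set.Iio w).indicator (fun s ↦ ENNReal.ofReal
        (if 0 < s then s / σ ^ 2 * exp (-s ^ 2 / (2 * σ ^ 2)) else 0)) =
      (Set.Ioo 0 w).indicator
        (fun s ↦ ENNReal.ofReal (s / σ ^ 2 * exp (-s ^ 2 / (2 * σ ^ 2)))) := by
    ext s
    by_cases h₀ : 0 < s <;> by_cases h₁ : s < w <;> simp [h₀, h₁]
  rw [rayleighMeasure, withDensity_apply _ measurableSet_Iio,
    ← lintegral_indicator measurableSet_Iio,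
    hind, lintegral_indicator measurableSet_Ioo, ← hint, intervalIntegral.integral_of_le hw,
    integral_Ioc_eq_integral_Ioo, ofReal_integral_eq_lintegral_ofReal]
  · exact (hcont.integrableOn_Icc (a := 0) (b := w)).mono_set Set.Ioo_subset_Icc_self
  · filter_upwards [ae_restrict_mem measurableSet_Ioo] with s hs
    have := hs.1
    simp only [Pi.zero_apply]
    positivity

lemma rayleighMeasure_Iio_of_nonpos {σ w : ℝ} (hw : w ≤ 0) :
    rayleighMeasure σ (Set.Iio w) = 0 := by
  rw [rayleighMeasure, withDensity_apply _ measurableSet_Iio,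
    setLIntegral_congr_fun (g := fun _ ↦ 0) measurableSet_Iio]
  · simp
  · intro s hs
    simp [not_lt.2 ((Set.mem_Iio.1 hs).le.trans hw)]

lemma setIntegral_exp_neg_sq_gaussianReal {μ σr σw : ℝ} (hσr : 0 < σr) (hσw : 0 < σw) :
    ∫ w in Set.Ioi 0, exp (-w ^ 2 / (2 * σr ^ 2)) ∂gaussianReal μ (.mk (σw ^ 2) (sq_nonneg σw)) =
      σr / √(σr ^ 2 + σw ^ 2) * stdNormalCDF (μ * σr / (σw * √(σr ^ 2 + σw ^ 2))) *
        exp (-μ ^ 2 / (2 * (σr ^ 2 + σw ^ 2))) := by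
  have hv : NNReal.mk (σw ^ 2) (sq_nonneg σw) ≠ 0 := by
    simpa [← NNReal.coe_ne_zero] using hσw.ne'
  set S := √(σr ^ 2 + σw ^ 2)
  have hSpos : 0 < S := by positivity
  have hSsq : S ^ 2 = σr ^ 2 + σw ^ 2 := Real.sq_sqrt (by positivity)
  set t := σr * σw / S with ht
  set m := μ * σr ^ 2 / S ^ 2 with hm
  have htpos : 0 < t := by positivity
  have hvt : NNReal.mk (t ^ 2) (sq_nonneg t) ≠ 0 := by
    simpa [← NNReal.coe_ne_zero] using htpos.ne'
  have harg : μ * σr / (σw * S) = m / t := by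
    rw [hm, ht]
    field_simp
  have hmul (w : ℝ) :
      gaussianPDFReal μ (.mk (σw ^ 2) (sq_nonneg σw)) w * exp (-w ^ 2 / (2 * σr ^ 2)) =
      (σr / S * exp (-μ ^ 2 / (2 * S ^ 2))) * gaussianPDFReal m (.mk (t ^ 2) (sq_nonneg t)) w := by
    have hexp : -(w - μ) ^ 2 / (2 * σw ^ 2) + -w ^ 2 / (2 * σr ^ 2) =
        -μ ^ 2 / (2 * S ^ 2) + -(w - m) ^ 2 / (2 * t ^ 2) := by
      rw [hm, ht]
      field_simp
      rw [hSsq]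
      ring
    simp only [gaussianPDFReal, NNReal.coe_mk]
    rw [mul_assoc, ← exp_add, hexp, exp_add, Real.sqrt_mul (by positivity),
      Real.sqrt_mul (by positivity) (t ^ 2), Real.sqrt_sq hσw.le, Real.sqrt_sq htpos.le, ht]
    field_simp
  rw [← hSsq, harg, ← gaussianReal_real_Ioi_zero m t htpos, Measure.real,
    gaussianReal_apply_eq_integral m hvt,
    ENNReal.toReal_ofReal (integral_nonneg fun _ ↦ gaussianPDFReal_nonneg _ _ _),
    ← integral_indicator measurableSet_Ioi, integral_gaussianReal_eq_integral_smul hv]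
  calc _ = ∫ w in Set.Ioi 0, (σr / S * exp (-μ ^ 2 / (2 * S ^ 2))) *
        gaussianPDFReal m (.mk (t ^ 2) (sq_nonneg t)) w := by
        rw [← integral_indicator measurableSet_Ioi]
        congr with w
        by_cases hw : w ∈ Set.Ioi (0 : ℝ) <;> simp [hw, ← hmul]
    _ = _ := by
        rw [integral_const_mul]
        ring

theorem stmt_1 {Ω : Type*} [MeasureSpace Ω] [IsProbabilityMeasure (ℙ : Measure Ω)]
    (R W : Ω → ℝ) (hRmeas : Measurable R) (hWmeas : Measurable W)
    (σr μ σw : ℝ) (hσr : 0 < σr) (hσw : 0 < σw)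
    (hInd : IndepFun R W ℙ)
    (hR : Measure.map R ℙ = rayleighMeasure σr)
    (hW : Measure.map W ℙ = gaussianReal μ ⟨σw ^ 2, sq_nonneg σw⟩) :
    (ℙ {ω | R ω < W ω}).toReal =
      stdNormalCDF (μ / σw) -
        (σr / σw) / Real.sqrt (1 + (σr / σw) ^ 2) *
          stdNormalCDF ((μ / σw) * (σr / σw) / Real.sqrt (1 + (σr / σw) ^ 2)) *
          Real.exp (-(μ / σw) ^ 2 / (2 * (1 + (σr / σw) ^ 2))) := by
  have hmS : MeasurableSet {p : ℝ × ℝ | p.1 < p.2} := measurableSet_lt measurable_fst measurable_snd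
  have hprob : IsProbabilityMeasure (rayleighMeasure σr) :=
    hR ▸ Measure.isProbabilityMeasure_map hRmeas.aemeasurable
  set G := gaussianReal μ (.mk (σw ^ 2) (sq_nonneg σw))
  replace hW : Measure.map W ℙ = G := hW
  have hle (w : ℝ) : exp (-w ^ 2 / (2 * σr ^ 2)) ≤ 1 :=
    exp_le_one_iff.2 (div_nonpos_of_nonpos_of_nonneg (by nlinarith [sq_nonneg w]) (by positivity))
  have hint : Integrable (fun w ↦ exp (-w ^ 2 / (2 * σr ^ 2))) G :=
    Integrable.of_bound (by fun_prop) 1 (ae_of_all _ fun w ↦ by simpa using hle w)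
  have hprod : ℙ {ω | R ω < W ω} = ∫⁻ w, rayleighMeasure σr (Set.Iio w) ∂G := by
    have h := (indepFun_iff_map_prod_eq_prod_map_map hRmeas.aemeasurable hWmeas.aemeasurable).1 hInd
    rw [hR, hW] at h
    change ℙ ((fun ω ↦ (R ω, W ω)) ⁻¹' {p : ℝ × ℝ | p.1 < p.2}) = _
    rw [← Measure.map_apply (hRmeas.prodMk hWmeas) hmS, h, Measure.prod_apply_symm hmS]
    rfl
  have hset : ∫⁻ w, rayleighMeasure σr (Set.Iio w) ∂G =
      ∫⁻ w in Set.Ioi 0, ENNReal.ofReal (1 - exp (-w ^ 2 / (2 * σr ^ 2))) ∂G := by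
    rw [← lintegral_indicator measurableSet_Ioi]
    congr with w
    by_cases hw : 0 < w
    · simp [hw, rayleighMeasure_Iio_of_nonneg hσr hw.le]
    · simp [hw, rayleighMeasure_Iio_of_nonpos (not_lt.1 hw)]
  have hsqrt : √(1 + (σr / σw) ^ 2) = √(σr ^ 2 + σw ^ 2) / σw := by
    rw [← Real.sqrt_sq hσw.le, ← Real.sqrt_div (by positivity), Real.sqrt_sq hσw.le]
    congr 1
    field_simp
    ring
  have hS : 0 < √(σr ^ 2 + σw ^ 2) := by positivity
  rw [hprod, hset, ← integral_eq_lintegral_of_nonneg_ae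
      (ae_of_all _ fun w ↦ sub_nonneg.2 (hle w)) (by fun_prop),
    integral_sub (integrable_const _) hint.integrableOn,
    setIntegral_exp_neg_sq_gaussianReal hσr hσw, setIntegral_const, smul_eq_mul, mul_one,
    gaussianReal_real_Ioi_zero μ σw hσw, hsqrt]
  have hcoef : σr / σw / (√(σr ^ 2 + σw ^ 2) / σw) = σr / √(σr ^ 2 + σw ^ 2) := by field_simp
  have harg : μ / σw * (σr / σw) / (√(σr ^ 2 + σw ^ 2) / σw) =
      μ * σr / (σw * √(σr ^ 2 + σw ^ 2)) := by field_simp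
  have hexp : -(μ / σw) ^ 2 / (2 * (1 + (σr / σw) ^ 2)) = -μ ^ 2 / (2 * (σr ^ 2 + σw ^ 2)) := by
    field_simp
    ring
  rw [hcoef, harg, hexp]
end

section
/- Let R and W be independent real random variables, where R has the Rayleigh distribution with parameter σ_r > 0 and W is normally distributed with mean 0 and variance σ_w² > 0. Then P(R < W) = (1/2)(1 − √(σ_r²/(σ_r² + σ_w²))). -/
open MeasureTheory ProbabilityTheory Real

lemma rayleighMeasure_Iio_of_pos {σ w : ℝ} (hσ : 0 < σ) (hw : 0 < w) :
    rayleighMeasure σ (Set.Iio w) = ENNReal.ofReal (1 - Real.exp (-w ^ 2 / (2 * σ ^ 2))) := by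
  have hcont : Continuous fun s : ℝ => s / σ ^ 2 * Real.exp (-s ^ 2 / (2 * σ ^ 2)) := by fun_prop
  have hderiv : ∀ s : ℝ, HasDerivAt (fun s => -Real.exp (-s ^ 2 / (2 * σ ^ 2)))
      (s / σ ^ 2 * Real.exp (-s ^ 2 / (2 * σ ^ 2))) s := by
    intro s
    have hexponent : HasDerivAt (fun s : ℝ => -s ^ 2 / (2 * σ ^ 2)) (-(2 * s) / (2 * σ ^ 2)) s := by
      simpa using (hasDerivAt_pow 2 s).fun_neg.div_const (2 * σ ^ 2)
    refine hexponent.exp.fun_neg.congr_deriv ?_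
    field
  have hind : (fun s : ℝ => ENNReal.ofReal
      (if 0 < s then s / σ ^ 2 * Real.exp (-s ^ 2 / (2 * σ ^ 2)) else 0)) =
      (Set.Ioi 0).indicator
        (fun s => ENNReal.ofReal (s / σ ^ 2 * Real.exp (-s ^ 2 / (2 * σ ^ 2)))) := by
    ext s
    by_cases hs : 0 < s <;> simp [hs]
  rw [rayleighMeasure, withDensity_apply _ measurableSet_Iio, hind,
    setLIntegral_indicator measurableSet_Ioi, Set.Ioi_inter_Iio, restrict_Ioo_eq_restrict_Ioc,
    ← ofReal_integral_eq_lintegral_ofReal, ← intervalIntegral.integral_of_le hw.le,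
    intervalIntegral.integral_eq_sub_of_hasDerivAt (fun s _ => hderiv s)
      (hcont.intervalIntegrable _ _)]
  · congr 1
    simp
    ring
  · exact (hcont.intervalIntegrable 0 w).1
  · filter_upwards [ae_restrict_mem measurableSet_Ioc] with s hs
    have := hs.1
    simp only [Pi.zero_apply]
    positivity

lemma integral_Ioi_gaussian_mul_rayleigh_cdf {σr σw : ℝ} (hσr : 0 < σr) (hσw : 0 < σw) :
    ∫ w in Set.Ioi (0 : ℝ), (√(2 * π * σw ^ 2))⁻¹ * Real.exp (-w ^ 2 / (2 * σw ^ 2)) *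
      (1 - Real.exp (-w ^ 2 / (2 * σr ^ 2))) =
      (1 / 2) * (1 - √(σr ^ 2 / (σr ^ 2 + σw ^ 2))) := by
  have ha : 0 < 1 / (2 * σw ^ 2) := by positivity
  have hb : 0 < 1 / (2 * σw ^ 2) + 1 / (2 * σr ^ 2) := by positivity
  have hsplit : ∀ w : ℝ, (√(2 * π * σw ^ 2))⁻¹ * Real.exp (-w ^ 2 / (2 * σw ^ 2)) *
      (1 - Real.exp (-w ^ 2 / (2 * σr ^ 2))) = (√(2 * π * σw ^ 2))⁻¹ *
        (Real.exp (-(1 / (2 * σw ^ 2)) * w ^ 2) -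
          Real.exp (-(1 / (2 * σw ^ 2) + 1 / (2 * σr ^ 2)) * w ^ 2)) := by
    intro w
    rw [show -(1 / (2 * σw ^ 2) + 1 / (2 * σr ^ 2)) * w ^ 2 =
      -w ^ 2 / (2 * σw ^ 2) + -w ^ 2 / (2 * σr ^ 2) by ring, Real.exp_add,
      show -(1 / (2 * σw ^ 2)) * w ^ 2 = -w ^ 2 / (2 * σw ^ 2) by ring]
    ring
  simp_rw [hsplit]
  rw [integral_const_mul, integral_sub (integrable_exp_neg_mul_sq ha).integrableOn
    (integrable_exp_neg_mul_sq hb).integrableOn, integral_gaussian_Ioi, integral_gaussian_Ioi,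
    show π / (1 / (2 * σw ^ 2)) = 2 * π * σw ^ 2 by field,
    show π / (1 / (2 * σw ^ 2) + 1 / (2 * σr ^ 2)) =
      2 * π * σw ^ 2 * (σr ^ 2 / (σr ^ 2 + σw ^ 2)) by field,
    Real.sqrt_mul (by positivity) (σr ^ 2 / (σr ^ 2 + σw ^ 2))]
  have hne : √(2 * π * σw ^ 2) ≠ 0 := by positivity
  generalize √(2 * π * σw ^ 2) = c at hne ⊢
  generalize √(σr ^ 2 / (σr ^ 2 + σw ^ 2)) = d
  field

theorem stmt_2 {Ω : Type*} [MeasureSpace Ω] [IsProbabilityMeasure (ℙ : Measure Ω)]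
    (R W : Ω → ℝ) (hRmeas : Measurable R) (hWmeas : Measurable W)
    (σr σw : ℝ) (hσr : 0 < σr) (hσw : 0 < σw)
    (hInd : IndepFun R W ℙ)
    (hR : Measure.map R ℙ = rayleighMeasure σr)
    (hW : Measure.map W ℙ = gaussianReal 0 ⟨σw ^ 2, sq_nonneg σw⟩) :
    (ℙ {ω | R ω < W ω}).toReal =
      (1 / 2) * (1 - Real.sqrt (σr ^ 2 / (σr ^ 2 + σw ^ 2))) := by
  obtain ⟨v, hvσ, hW⟩ : ∃ v : NNReal, (v : ℝ) = σw ^ 2 ∧ Measure.map W ℙ = gaussianReal 0 v :=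
    ⟨⟨σw ^ 2, sq_nonneg σw⟩, rfl, hW⟩
  have hv : v ≠ 0 := by
    rintro rfl
    exact (pow_pos hσw 2).ne hvσ
  have hprob : IsProbabilityMeasure (rayleighMeasure σr) :=
    hR ▸ Measure.isProbabilityMeasure_map hRmeas.aemeasurable
  have hjoint := (indepFun_iff_map_prod_eq_prod_map_map hRmeas.aemeasurable
    hWmeas.aemeasurable).mp hInd
  have hlt : MeasurableSet {p : ℝ × ℝ | p.1 < p.2} :=
    measurableSet_lt measurable_fst measurable_snd
  have hset : ℙ {ω | R ω < W ω} =
      ∫⁻ w, rayleighMeasure σr (Set.Iio w) ∂gaussianReal 0 v := by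
    rw [show {ω | R ω < W ω} = (fun ω => (R ω, W ω)) ⁻¹' {p : ℝ × ℝ | p.1 < p.2} from rfl,
      ← Measure.map_apply (hRmeas.prodMk hWmeas) hlt, hjoint, hR, hW,
      Measure.prod_apply_symm hlt]
    rfl
  have hmeas : Measurable fun w => rayleighMeasure σr (Set.Iio w) :=
    measurable_measure_prodMk_right hlt
  have hdens : ∀ w : ℝ, (gaussianPDF 0 v *
      fun w => rayleighMeasure σr (Set.Iio w)) w =
      (Set.Ioi 0).indicator (fun w => ENNReal.ofReal ((√(2 * π * σw ^ 2))⁻¹ *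
        Real.exp (-w ^ 2 / (2 * σw ^ 2)) * (1 - Real.exp (-w ^ 2 / (2 * σr ^ 2))))) w := by
    intro w
    by_cases hw : 0 < w
    · rw [Pi.mul_apply, rayleighMeasure_Iio_of_pos hσr hw, Set.indicator_of_mem (by exact hw),
        ENNReal.ofReal_mul (by positivity), gaussianPDF, gaussianPDFReal]
      simp only [sub_zero, hvσ]
    · rw [Pi.mul_apply, rayleighMeasure_Iio_of_nonpos (not_lt.mp hw), mul_zero,
        Set.indicator_of_notMem (by exact hw)]
  rw [hset, gaussianReal_of_var_ne_zero _ hv,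
    lintegral_withDensity_eq_lintegral_mul _ (measurable_gaussianPDF _ _) hmeas,
    lintegral_congr hdens, lintegral_indicator measurableSet_Ioi,
    ← integral_eq_lintegral_of_nonneg_ae, integral_Ioi_gaussian_mul_rayleigh_cdf hσr hσw]
  · refine ae_of_all _ fun w => ?_
    have : Real.exp (-w ^ 2 / (2 * σr ^ 2)) ≤ 1 := by
      rw [Real.exp_le_one_iff, neg_div]
      exact neg_nonpos.mpr (by positivity)
    exact mul_nonneg (by positivity) (sub_nonneg.mpr this)
  · exact Continuous.aestronglyMeasurable (by fun_prop)
end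

section
/- Let u ∈ ℝ, λ > 0, ρ ∈ (−1,1) and ρ' ∈ ℝ be such that σ² := 1 − ρ² − ρ'²/λ > 0. Let R have the Rayleigh(1) distribution and let Z be a standard normal random variable independent of R. Then 2·P(uρ − (ρ'/√λ)·R + σ·Z > u) − 1 = 1 − 2Φ(u(1−ρ)/√(1−ρ²−ρ'²/λ)) − 2·(1/√λ)·(ρ'/√(1−ρ²)) · exp(−(u²/2)·(1−ρ)/(1+ρ)) · Φ((−u/√λ)·√((1−ρ)/(1+ρ))·ρ'/√(1−ρ²−ρ'²/λ)). (This is the formula for the expected value E_u^+(t) of the clipped Slepian model at a u-level up-crossing of a stationary Gaussian process with normalized covariance r, evaluated at a fixed time t, with ρ = r(t), ρ' = r'(t), λ = −r''(0), since the Slepian model satisfies X_u(t) = u·r(t) − R·r'(t)/√(−r''(0)) + Δ(t) where Δ(t) is a centered Gaussian variable with variance 1 − r(t)² + r'(t)²/r''(0), independent of the Rayleigh(1) variable R.) -/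
open MeasureTheory ProbabilityTheory Real

open Filter Set Topology

lemma gaussianPDFReal_zero_one (z : ℝ) :
    gaussianPDFReal 0 1 z = (√(2 * π))⁻¹ * rexp (-z ^ 2 / 2) := by
  simp [gaussianPDFReal]

lemma stdNormalCDF_eq_real_Iic (x : ℝ) : stdNormalCDF x = (gaussianReal 0 1).real (Iic x) := by
  rw [measureReal_def, gaussianReal_apply_eq_integral 0 one_ne_zero,
    ENNReal.toReal_ofReal (integral_nonneg fun z => gaussianPDFReal_nonneg 0 1 z)]
  simp only [gaussianPDFReal_zero_one, stdNormalCDF]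

lemma stdNormalCDF_eq_cdf (x : ℝ) : stdNormalCDF x = cdf (gaussianReal 0 1) x := by
  rw [cdf_eq_real, stdNormalCDF_eq_real_Iic]

lemma gaussianReal_real_Ioi_neg (x : ℝ) :
    (gaussianReal 0 1).real (Ioi (-x)) = stdNormalCDF x := by
  rw [measureReal_def, gaussianReal_apply_eq_integral 0 one_ne_zero,
    ENNReal.toReal_ofReal (integral_nonneg fun z => gaussianPDFReal_nonneg 0 1 z),
    ← integral_comp_neg_Iic]
  simp only [gaussianPDFReal_zero_one, stdNormalCDF, neg_sq]

lemma stdNormalCDF_neg (x : ℝ) : stdNormalCDF (-x) = 1 - stdNormalCDF x := by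
  rw [← gaussianReal_real_Ioi_neg x, stdNormalCDF_eq_real_Iic, ← compl_Iic,
    probReal_compl_eq_one_sub measurableSet_Iic]
  ring

lemma stdNormalCDF_nonneg (x : ℝ) : 0 ≤ stdNormalCDF x := by
  rw [stdNormalCDF_eq_cdf]; exact cdf_nonneg _ x

lemma stdNormalCDF_le_one (x : ℝ) : stdNormalCDF x ≤ 1 := by
  rw [stdNormalCDF_eq_cdf]; exact cdf_le_one _ x

lemma tendsto_stdNormalCDF_atTop : Tendsto stdNormalCDF atTop (𝓝 1) :=
  (tendsto_cdf_atTop (gaussianReal 0 1)).congr fun x => (stdNormalCDF_eq_cdf x).symm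

lemma hasDerivAt_stdNormalCDF (x : ℝ) :
    HasDerivAt stdNormalCDF ((√(2 * π))⁻¹ * rexp (-x ^ 2 / 2)) x := by
  set φ : ℝ → ℝ := fun z => (√(2 * π))⁻¹ * rexp (-z ^ 2 / 2)
  have hcont : Continuous φ := by fun_prop
  have hint : Integrable φ :=
    (integrable_gaussianPDFReal 0 1).congr (ae_of_all _ gaussianPDFReal_zero_one)
  have hderiv : HasDerivAt (fun t => stdNormalCDF 0 + ∫ z in (0 : ℝ)..t, φ z) (φ x) x :=
    (intervalIntegral.integral_hasDerivAt_right (hcont.intervalIntegrable _ _)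
      hcont.aestronglyMeasurable.stronglyMeasurableAtFilter hcont.continuousAt).const_add _
  convert! hderiv using 1
  ext t
  rw [← intervalIntegral.integral_Iic_sub_Iic hint.integrableOn hint.integrableOn]
  simp [stdNormalCDF, φ]

lemma tendsto_exp_neg_sq_div_two_atTop :
    Tendsto (fun s : ℝ => rexp (-s ^ 2 / 2)) atTop (𝓝 0) := by
  refine tendsto_exp_atBot.comp ?_
  simp_rw [neg_div]
  exact tendsto_neg_atTop_atBot.comp
    ((tendsto_pow_atTop two_ne_zero).atTop_div_const two_pos)

/-- The mean of `Φ(a + d R)` for a Rayleigh(1) variable `R`. -/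
lemma integral_Ioi_mul_exp_mul_stdNormalCDF (a d : ℝ) {κ : ℝ} (hκ : 0 < κ)
    (hκd : κ ^ 2 = 1 + d ^ 2) :
    ∫ s in Ioi (0 : ℝ), s * rexp (-s ^ 2 / 2) * stdNormalCDF (a + d * s) =
      stdNormalCDF a + d / κ * rexp (-(a / κ) ^ 2 / 2) * stdNormalCDF (-(a * d / κ)) := by
  set E := rexp (-(a / κ) ^ 2 / 2) with hE
  have hderiv (s : ℝ) : HasDerivAt
      (fun s => -rexp (-s ^ 2 / 2) * stdNormalCDF (a + d * s)
        + d / κ * E * stdNormalCDF (κ * s + a * d / κ))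
      (s * rexp (-s ^ 2 / 2) * stdNormalCDF (a + d * s)) s := by
    have hexp : HasDerivAt (fun s : ℝ => -rexp (-s ^ 2 / 2)) (s * rexp (-s ^ 2 / 2)) s := by
      convert! (((hasDerivAt_pow 2 s).neg.div_const 2).exp).neg using 1
      simp; ring
    have hlin₁ : HasDerivAt (fun s : ℝ => a + d * s) d s := by
      simpa using ((hasDerivAt_id s).const_mul d).const_add a
    have hlin₂ : HasDerivAt (fun s : ℝ => κ * s + a * d / κ) κ s := by
      simpa using ((hasDerivAt_id s).const_mul κ).add_const (a * d / κ)
    have hsquare : rexp (-s ^ 2 / 2) * rexp (-(a + d * s) ^ 2 / 2) =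
        E * rexp (-(κ * s + a * d / κ) ^ 2 / 2) := by
      rw [hE, ← Real.exp_add, ← Real.exp_add]
      congr 1
      have h : (a / κ) ^ 2 + (κ * s + a * d / κ) ^ 2 = s ^ 2 + (a + d * s) ^ 2 := by
        field_simp
        linear_combination (-a ^ 2 + s ^ 2 * κ ^ 2) * hκd
      linear_combination h / 2
    convert! (hexp.mul ((hasDerivAt_stdNormalCDF _).comp s hlin₁)).add
      (((hasDerivAt_stdNormalCDF _).comp s hlin₂).const_mul (d / κ * E)) using 1
    have hdκ : d / κ * κ = d := div_mul_cancel₀ d hκ.ne'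
    simp only [Function.comp]
    linear_combination (√(2 * π))⁻¹ * d * hsquare
      - E * (√(2 * π))⁻¹ * rexp (-(κ * s + a * d / κ) ^ 2 / 2) * hdκ
  have hlim₁ : Tendsto (fun s => -rexp (-s ^ 2 / 2) * stdNormalCDF (a + d * s)) atTop (𝓝 0) := by
    refine squeeze_zero_norm (fun s => ?_) tendsto_exp_neg_sq_div_two_atTop
    rw [norm_mul, norm_neg, Real.norm_of_nonneg (exp_pos _).le,
      Real.norm_of_nonneg (stdNormalCDF_nonneg _)]
    exact mul_le_of_le_one_right (exp_pos _).le (stdNormalCDF_le_one _)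
  have hlim₂ : Tendsto (fun s => stdNormalCDF (κ * s + a * d / κ)) atTop (𝓝 1) :=
    tendsto_stdNormalCDF_atTop.comp
      (tendsto_atTop_add_const_right _ _ (tendsto_id.const_mul_atTop hκ))
  rw [integral_Ioi_of_hasDerivAt_of_nonneg' (fun s _ => hderiv s)
    (fun s hs => mul_nonneg (mul_nonneg (le_of_lt hs) (exp_pos _).le) (stdNormalCDF_nonneg _))
    (hlim₁.add (hlim₂.const_mul _)), stdNormalCDF_neg]
  simp
  ring

lemma integral_rayleighMeasure_one (g : ℝ → ℝ) :
    ∫ s, g s ∂rayleighMeasure 1 = ∫ s in Ioi (0 : ℝ), s * rexp (-s ^ 2 / 2) * g s := by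
  rw [rayleighMeasure, integral_withDensity_eq_integral_toReal_smul,
    ← integral_indicator measurableSet_Ioi]
  · congr 1 with s
    by_cases hs : 0 < s
    · have : 0 ≤ s * rexp (-s ^ 2 / 2) := by positivity
      simp [hs, ENNReal.toReal_ofReal this]
    · simp [hs]
  · exact (Measurable.ite measurableSet_Ioi (by fun_prop) measurable_const).ennreal_ofReal
  · simp

lemma measureReal_neg_lt_affine_eq_integral {Ω : Type*} [MeasurableSpace Ω] {μ : Measure Ω}
    [IsProbabilityMeasure μ] {R Z : Ω → ℝ} (hR : Measurable R) (hZ : Measurable Z)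
    (hInd : IndepFun R Z μ) (hZlaw : μ.map Z = gaussianReal 0 1) (a d : ℝ) :
    μ.real {ω | -(a + d * R ω) < Z ω} = ∫ s, stdNormalCDF (a + d * s) ∂μ.map R := by
  have hS : MeasurableSet {p : ℝ × ℝ | -(a + d * p.1) < p.2} :=
    measurableSet_lt (by fun_prop) (by fun_prop)
  have hpre : {ω | -(a + d * R ω) < Z ω} =
      (fun ω => (R ω, Z ω)) ⁻¹' {p : ℝ × ℝ | -(a + d * p.1) < p.2} := rfl
  rw [measureReal_def, hpre, ← Measure.map_apply (hR.prodMk hZ) hS,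
    hInd.map_prod_eq_prod_map_map hR.aemeasurable hZ.aemeasurable, hZlaw,
    Measure.prod_apply hS, ← integral_toReal (measurable_measure_prodMk_left hS).aemeasurable
      (ae_of_all _ fun s => measure_lt_top _ _)]
  congr 1 with s
  exact gaussianReal_real_Ioi_neg (a + d * s)

lemma sqrt_one_sub_div_one_add {ρ : ℝ} (hρ : ρ ∈ Ioo (-1 : ℝ) 1) :
    √((1 - ρ) / (1 + ρ)) = (1 - ρ) / √(1 - ρ ^ 2) := by
  have h₁ : 0 < 1 + ρ := by linarith [hρ.1]
  have h₂ : 0 < 1 - ρ := by linarith [hρ.2]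
  rw [show (1 - ρ) / (1 + ρ) = (1 - ρ) ^ 2 / (1 - ρ ^ 2) by
    rw [show 1 - ρ ^ 2 = (1 - ρ) * (1 + ρ) by ring]; field_simp,
    Real.sqrt_div (sq_nonneg _), Real.sqrt_sq h₂.le]

theorem stmt_3 {Ω : Type*} [MeasureSpace Ω] [IsProbabilityMeasure (ℙ : Measure Ω)]
    (R Z : Ω → ℝ) (hRmeas : Measurable R) (hZmeas : Measurable Z)
    (hInd : IndepFun R Z ℙ)
    (hR : Measure.map R ℙ = rayleighMeasure 1)
    (hZ : Measure.map Z ℙ = gaussianReal 0 1)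
    (u lam ρ ρ' : ℝ) (hlam : 0 < lam) (hρ : ρ ∈ Set.Ioo (-1 : ℝ) 1)
    (hσ : 0 < 1 - ρ ^ 2 - ρ' ^ 2 / lam) :
    2 * (ℙ {ω | u * ρ - (ρ' / Real.sqrt lam) * R ω
          + Real.sqrt (1 - ρ ^ 2 - ρ' ^ 2 / lam) * Z ω > u}).toReal - 1 =
      1 - 2 * stdNormalCDF (u * (1 - ρ) / Real.sqrt (1 - ρ ^ 2 - ρ' ^ 2 / lam))
        - 2 * (1 / Real.sqrt lam) * (ρ' / Real.sqrt (1 - ρ ^ 2))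
            * Real.exp (-(u ^ 2 / 2) * (1 - ρ) / (1 + ρ))
            * stdNormalCDF ((-u / Real.sqrt lam) * Real.sqrt ((1 - ρ) / (1 + ρ)) * ρ'
                / Real.sqrt (1 - ρ ^ 2 - ρ' ^ 2 / lam)) := by
  have hρadd : 0 < 1 + ρ := by linarith [hρ.1]
  have hρsub : 0 < 1 - ρ := by linarith [hρ.2]
  have hρsq : 0 < 1 - ρ ^ 2 := by nlinarith
  rw [sqrt_one_sub_div_one_add hρ]
  set σ := √(1 - ρ ^ 2 - ρ' ^ 2 / lam) with hσdef
  set κ := √(1 - ρ ^ 2)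
  set l := √lam with hldef
  have hσpos : 0 < σ := Real.sqrt_pos.2 hσ
  have hκpos : 0 < κ := Real.sqrt_pos.2 hρsq
  have hlpos : 0 < l := Real.sqrt_pos.2 hlam
  have hκsq : κ ^ 2 = 1 - ρ ^ 2 := Real.sq_sqrt hρsq.le
  have hσsq : σ ^ 2 = κ ^ 2 - (ρ' / l) ^ 2 := by
    rw [div_pow, hldef, Real.sq_sqrt hlam.le, hκsq, hσdef, Real.sq_sqrt hσ.le]
  have hevent : {ω | u * ρ - ρ' / l * R ω + σ * Z ω > u} =
      {ω | -(-(u * (1 - ρ) / σ) + -(ρ' / l / σ) * R ω) < Z ω} := by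
    ext ω
    have h : -(-(u * (1 - ρ) / σ) + -(ρ' / l / σ) * R ω) =
        (u * (1 - ρ) + ρ' / l * R ω) / σ := by ring
    simp only [mem_ofPred_eq, h, div_lt_iff₀ hσpos]
    constructor <;> intro h <;> linarith
  have hnorm : (κ / σ) ^ 2 = 1 + (-(ρ' / l / σ)) ^ 2 := by
    rw [neg_sq, div_pow, div_pow _ σ, show κ ^ 2 = σ ^ 2 + (ρ' / l) ^ 2 by linarith, add_div,
      div_self (pow_ne_zero 2 hσpos.ne')]
  have hexp : -(-(u * (1 - ρ) / σ) / (κ / σ)) ^ 2 / 2 = -(u ^ 2 / 2) * (1 - ρ) / (1 + ρ) := by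
    have : (-(u * (1 - ρ) / σ) / (κ / σ)) ^ 2 = u ^ 2 * (1 - ρ) ^ 2 / κ ^ 2 := by
      field_simp
    rw [neg_div, this, hκsq, show 1 - ρ ^ 2 = (1 - ρ) * (1 + ρ) by ring]
    field_simp
  have harg : -(-(u * (1 - ρ) / σ) * -(ρ' / l / σ) / (κ / σ)) =
      -u / l * ((1 - ρ) / κ) * ρ' / σ := by
    field_simp
  have hcoef : -(ρ' / l / σ) / (κ / σ) = -(1 / l * (ρ' / κ)) := by
    field_simp
  rw [hevent, ← measureReal_def,
    measureReal_neg_lt_affine_eq_integral hRmeas hZmeas hInd hZ, hR,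
    integral_rayleighMeasure_one,
    integral_Ioi_mul_exp_mul_stdNormalCDF _ _ (div_pos hκpos hσpos) hnorm,
    hexp, harg, hcoef, stdNormalCDF_neg]
  ring
end

section
/- Let λ > 0, ρ ∈ (−1,1) and ρ' ∈ ℝ be such that σ² := 1 − ρ² − ρ'²/λ > 0. Let R have the Rayleigh(1) distribution and let Z be a standard normal random variable independent of R. Then 2·P(−(ρ'/√λ)·R + σ·Z > 0) − 1 = −(1/√λ)·ρ'/√(1−ρ²). (This is the zero-level specialization of the expected value of the clipped Slepian model: E_0^+(t) = −(1/√(−r''(0)))·r'(t)/√(1−r(t)²) with ρ = r(t), ρ' = r'(t), λ = −r''(0).) -/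
open MeasureTheory ProbabilityTheory Real

open Filter Topology Set

lemma rayleighMeasure_one_Ioi {t : ℝ} (ht : 0 ≤ t) :
    rayleighMeasure 1 (Ioi t) = ENNReal.ofReal (exp (-t ^ 2 / 2)) := by
  have hderiv : ∀ x ∈ Ici t,
      HasDerivAt (fun s : ℝ => -exp (-s ^ 2 / 2)) (x * exp (-x ^ 2 / 2)) x := by
    intro x _
    have h : HasDerivAt (fun s : ℝ => -s ^ 2 / 2) (-(2 * x) / 2) x := by
      simpa using (hasDerivAt_pow 2 x).fun_neg.div_const 2
    exact h.exp.fun_neg.congr_deriv (by ring)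
  have hpos : ∀ x ∈ Ioi t, 0 ≤ x * exp (-x ^ 2 / 2) := fun x hx =>
    mul_nonneg (ht.trans (le_of_lt hx)) (exp_pos _).le
  have hlim : Tendsto (fun s : ℝ => -exp (-s ^ 2 / 2)) atTop (𝓝 0) := by
    have h : Tendsto (fun s : ℝ => s ^ 2 / 2) atTop atTop :=
      (tendsto_pow_atTop two_ne_zero).atTop_div_const two_pos
    simpa [Function.comp_def, neg_div] using (tendsto_exp_neg_atTop_nhds_zero.comp h).neg
  rw [rayleighMeasure, withDensity_apply _ measurableSet_Ioi]
  have hcongr : ∀ s ∈ Ioi t, ENNReal.ofReal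
      (if 0 < s then s / 1 ^ 2 * exp (-s ^ 2 / (2 * 1 ^ 2)) else 0) =
      ENNReal.ofReal (s * exp (-s ^ 2 / 2)) := by
    intro s hs
    simp [ht.trans_lt hs]
  rw [setLIntegral_congr_fun measurableSet_Ioi hcongr, ← ofReal_integral_eq_lintegral_ofReal
    (integrableOn_Ioi_deriv_of_nonneg' hderiv hpos hlim)
    ((ae_restrict_iff' measurableSet_Ioi).2 (ae_of_all _ hpos)),
    integral_Ioi_of_hasDerivAt_of_nonneg' hderiv hpos hlim]
  simp

lemma rayleighMeasure_one_real_Ioi_of_nonneg {t : ℝ} (ht : 0 ≤ t) :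
    (rayleighMeasure 1).real (Ioi t) = exp (-t ^ 2 / 2) := by
  rw [measureReal_def, rayleighMeasure_one_Ioi ht, ENNReal.toReal_ofReal (exp_pos _).le]

section

variable [IsProbabilityMeasure (rayleighMeasure 1)]

lemma rayleighMeasure_one_real_Ioi_of_nonpos {t : ℝ} (ht : t ≤ 0) :
    (rayleighMeasure 1).real (Ioi t) = 1 := by
  refine le_antisymm measureReal_le_one ?_
  calc (1 : ℝ) = (rayleighMeasure 1).real (Ioi 0) := by
        simp [rayleighMeasure_one_real_Ioi_of_nonneg le_rfl]
    _ ≤ _ := measureReal_mono (Ioi_subset_Ioi ht)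

lemma rayleighMeasure_one_real_Iio (t : ℝ) :
    (rayleighMeasure 1).real (Iio t) = 1 - (rayleighMeasure 1).real (Ioi t) := by
  have hac : rayleighMeasure 1 ≪ volume := withDensity_absolutelyContinuous _ _
  have h : (rayleighMeasure 1).real (Iio t) = (rayleighMeasure 1).real (Iic t) :=
    measureReal_congr (hac.ae_eq Iio_ae_eq_Iic)
  rw [h, ← compl_Ioi, probReal_compl_eq_one_sub measurableSet_Ioi]

lemma rayleighMeasure_one_real_Ioi_add_neg (t : ℝ) :
    (rayleighMeasure 1).real (Ioi t) + (rayleighMeasure 1).real (Ioi (-t)) =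
      1 + exp (-t ^ 2 / 2) := by
  rcases le_total 0 t with ht | ht
  · rw [rayleighMeasure_one_real_Ioi_of_nonneg ht,
      rayleighMeasure_one_real_Ioi_of_nonpos (neg_nonpos.2 ht), add_comm]
  · rw [rayleighMeasure_one_real_Ioi_of_nonpos ht,
      rayleighMeasure_one_real_Ioi_of_nonneg (neg_nonneg.2 ht), neg_sq]

lemma rayleighMeasure_one_real_lt_add_neg (c : ℝ) {s z : ℝ} (hs : 0 < s) (hz : z ≠ 0) :
    (rayleighMeasure 1).real {r | c * r < s * z} +
        (rayleighMeasure 1).real {r | c * r < s * -z} =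
      1 - SignType.sign c * exp (-((s / c) ^ 2 / 2) * z ^ 2) := by
  rcases lt_trichotomy c 0 with hc | rfl | hc
  · have key (y : ℝ) : {r | c * r < s * y} = Ioi (s / c * y) := by
      ext r
      rw [mem_ofPred_eq, mem_Ioi, div_mul_eq_mul_div, div_lt_iff_of_neg hc, mul_comm r]
    rw [key, key, mul_neg, rayleighMeasure_one_real_Ioi_add_neg, sign_neg hc]
    have : -(s / c * z) ^ 2 / 2 = -((s / c) ^ 2 / 2) * z ^ 2 := by ring
    rw [this]
    simp
  · rcases lt_or_gt_of_ne hz with hz | hz <;> simp [mul_neg_iff, hs, hz, hs.not_gt, hz.not_gt]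
  · have key (y : ℝ) : {r | c * r < s * y} = Iio (s / c * y) := by
      ext r
      rw [mem_ofPred_eq, mem_Iio, div_mul_eq_mul_div, lt_div_iff₀ hc, mul_comm r]
    rw [key, key, mul_neg, rayleighMeasure_one_real_Iio, rayleighMeasure_one_real_Iio, sign_pos hc]
    have h := rayleighMeasure_one_real_Ioi_add_neg (s / c * z)
    have : -(s / c * z) ^ 2 / 2 = -((s / c) ^ 2 / 2) * z ^ 2 := by ring
    rw [this] at h
    rw [SignType.coe_one]
    linarith

end

lemma integral_exp_neg_mul_sq_gaussianReal {b : ℝ} (hb : 0 ≤ b) :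
    ∫ z, exp (-b * z ^ 2) ∂gaussianReal 0 1 = (√(1 + 2 * b))⁻¹ := by
  rw [integral_gaussianReal_eq_integral_smul one_ne_zero]
  have h (z : ℝ) : gaussianPDFReal 0 1 z • exp (-b * z ^ 2) =
      (√(2 * π))⁻¹ * exp (-(b + 1 / 2) * z ^ 2) := by
    rw [gaussianPDFReal_def, smul_eq_mul, mul_assoc, ← exp_add]
    simp only [NNReal.coe_one, mul_one, sub_zero]
    ring_nf
  simp_rw [h]
  rw [integral_const_mul, integral_gaussian, ← sqrt_inv, ← sqrt_mul (by positivity), ← sqrt_inv]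
  congr 1
  have : 0 < b + 1 / 2 := by positivity
  have : 0 < 1 + 2 * b := by positivity
  field_simp
  ring

lemma sign_mul_inv_sqrt_one_add_div_sq (c s : ℝ) :
    SignType.sign c * (√(1 + 2 * ((s / c) ^ 2 / 2)))⁻¹ = c / √(c ^ 2 + s ^ 2) := by
  rcases eq_or_ne c 0 with rfl | hc
  · simp
  have h : 1 + 2 * ((s / c) ^ 2 / 2) = (c ^ 2 + s ^ 2) / c ^ 2 := by field_simp
  rw [h, sqrt_div (by positivity), sqrt_sq_eq_abs, inv_div, ← mul_div_assoc, sign_mul_abs]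

/-- If `R` is Rayleigh(1) and `Z` is an independent standard normal variable, then
`2 P(c R < s Z) = 1 - c / √(c² + s²)`. -/
lemma two_mul_prob_mul_rayleigh_lt_mul_gaussian {Ω : Type*} [MeasurableSpace Ω] {P : Measure Ω}
    [IsProbabilityMeasure P] {R Z : Ω → ℝ} (hR : Measurable R) (hZ : Measurable Z)
    (hRZ : IndepFun R Z P) (hRlaw : P.map R = rayleighMeasure 1)
    (hZlaw : P.map Z = gaussianReal 0 1) (c : ℝ) {s : ℝ} (hs : 0 < s) :
    2 * P.real {ω | c * R ω < s * Z ω} = 1 - c / √(c ^ 2 + s ^ 2) := by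
  have : IsProbabilityMeasure (rayleighMeasure 1) :=
    hRlaw ▸ Measure.isProbabilityMeasure_map hR.aemeasurable
  let S : Set (ℝ × ℝ) := {p | c * p.2 < s * p.1}
  have hS : MeasurableSet S := measurableSet_lt (by fun_prop) (by fun_prop)
  let G : ℝ → ℝ := fun z => (rayleighMeasure 1).real {r | c * r < s * z}
  have hmap : P.map (fun ω => (Z ω, R ω)) = (gaussianReal 0 1).prod (rayleighMeasure 1) := by
    rw [← hRlaw, ← hZlaw]
    exact (indepFun_iff_map_prod_eq_prod_map_map hZ.aemeasurable hR.aemeasurable).1 hRZ.symm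
  have hGint : Integrable G (gaussianReal 0 1) :=
    Measure.integrable_measure_prodMk_left hS (measure_ne_top _ _)
  have hprob : P.real {ω | c * R ω < s * Z ω} = ∫ z, G z ∂gaussianReal 0 1 := by
    calc P.real {ω | c * R ω < s * Z ω} = (P.map (fun ω => (Z ω, R ω))).real S :=
          (map_measureReal_apply (hZ.prodMk hR) hS).symm
      _ = ∫ z, G z ∂gaussianReal 0 1 := by
          rw [hmap, measureReal_def, Measure.prod_apply hS]
          exact (integral_toReal (measurable_measure_prodMk_left hS).aemeasurable
            (ae_of_all _ fun _ => measure_lt_top _ _)).symm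
  have hneg : (gaussianReal 0 1).map (fun x => -x) = gaussianReal 0 1 := by
    simpa using gaussianReal_map_neg (μ := 0) (v := 1)
  have hmp : MeasurePreserving (fun x : ℝ => -x) (gaussianReal 0 1) (gaussianReal 0 1) :=
    ⟨measurable_neg, hneg⟩
  have hsymm : ∫ z, G (-z) ∂gaussianReal 0 1 = ∫ z, G z ∂gaussianReal 0 1 :=
    hmp.integral_comp (MeasurableEquiv.neg ℝ).measurableEmbedding G
  have hsum : (fun z => G z + G (-z)) =ᵐ[gaussianReal 0 1]
      fun z => 1 - SignType.sign c * exp (-((s / c) ^ 2 / 2) * z ^ 2) := by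
    have : NullSingletonClass (gaussianReal 0 1) := nullSingletonClass_gaussianReal one_ne_zero
    filter_upwards [compl_mem_ae_iff.2 (measure_singleton (μ := gaussianReal 0 1) (0 : ℝ))] with z hz
    exact rayleighMeasure_one_real_lt_add_neg c hs hz
  have hexp : Integrable (fun z => exp (-((s / c) ^ 2 / 2) * z ^ 2)) (gaussianReal 0 1) := by
    refine Integrable.of_bound (by fun_prop) 1 (ae_of_all _ fun z => ?_)
    rw [norm_of_nonneg (exp_pos _).le, exp_le_one_iff, neg_mul]
    exact neg_nonpos.2 (by positivity)
  calc 2 * P.real {ω | c * R ω < s * Z ω}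
      = ∫ z, (G z + G (-z)) ∂gaussianReal 0 1 := by
        have hGneg : Integrable (fun z => G (-z)) (gaussianReal 0 1) :=
          hmp.integrable_comp_of_integrable hGint
        rw [integral_add hGint hGneg, hsymm, hprob, two_mul]
    _ = 1 - SignType.sign c * (√(1 + 2 * ((s / c) ^ 2 / 2)))⁻¹ := by
        rw [integral_congr_ae hsum, integral_sub (integrable_const _) (hexp.const_mul _),
          integral_const_mul, integral_exp_neg_mul_sq_gaussianReal (by positivity)]
        simp
    _ = 1 - c / √(c ^ 2 + s ^ 2) := by rw [sign_mul_inv_sqrt_one_add_div_sq]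

theorem stmt_4 {Ω : Type*} [MeasureSpace Ω] [IsProbabilityMeasure (ℙ : Measure Ω)]
    (R Z : Ω → ℝ) (hRmeas : Measurable R) (hZmeas : Measurable Z)
    (hInd : IndepFun R Z ℙ)
    (hR : Measure.map R ℙ = rayleighMeasure 1)
    (hZ : Measure.map Z ℙ = gaussianReal 0 1)
    (lam ρ ρ' : ℝ) (hlam : 0 < lam) (hρ : ρ ∈ Set.Ioo (-1 : ℝ) 1)
    (hσ : 0 < 1 - ρ ^ 2 - ρ' ^ 2 / lam) :
    2 * (ℙ {ω | -(ρ' / Real.sqrt lam) * R ω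
          + Real.sqrt (1 - ρ ^ 2 - ρ' ^ 2 / lam) * Z ω > 0}).toReal - 1 =
      -(1 / Real.sqrt lam) * ρ' / Real.sqrt (1 - ρ ^ 2) := by
  have hset : {ω | -(ρ' / Real.sqrt lam) * R ω
      + Real.sqrt (1 - ρ ^ 2 - ρ' ^ 2 / lam) * Z ω > 0} =
      {ω | ρ' / √lam * R ω < √(1 - ρ ^ 2 - ρ' ^ 2 / lam) * Z ω} := by
    ext ω
    simp only [mem_ofPred_eq, gt_iff_lt]
    constructor <;> intro h <;> linarith
  have hvar : (ρ' / √lam) ^ 2 + √(1 - ρ ^ 2 - ρ' ^ 2 / lam) ^ 2 = 1 - ρ ^ 2 := by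
    rw [sq_sqrt hσ.le, div_pow, sq_sqrt hlam.le]
    ring
  rw [hset, ← measureReal_def, two_mul_prob_mul_rayleigh_lt_mul_gaussian hRmeas hZmeas hInd hR hZ _
    (sqrt_pos.2 hσ), hvar]
  ring
end

section
/- Let r : ℝ → ℝ be twice continuously differentiable with r(0) = 1, r'(0) = 0 and r''(0) < 0, and suppose there exists ε > 0 such that for all 0 < t < ε one has −1 < r(t) < 1 and 1 − r(t)² + r'(t)²/r''(0) > 0. For u ∈ ℝ define E_u^+(t) = 1 − 2Φ(u(1−r(t))/√(1−r(t)²+r'(t)²/r''(0))) − 2·(1/√(−r''(0)))·(r'(t)/√(1−r(t)²)) · exp(−(u²/2)·(1−r(t))/(1+r(t))) · Φ((−u/√(−r''(0)))·√((1−r(t))/(1+r(t)))·r'(t)/√(1−r(t)²+r'(t)²/r''(0))). Then lim_{t→0+} E_u^+(t) = 1. -/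
open MeasureTheory Real Filter

/-- The expected value function `E_u^+` of the clipped Slepian model at a `u`-level
up-crossing of a stationary Gaussian process with normalized covariance `r`. -/
noncomputable def EuPlus (r : ℝ → ℝ) (u t : ℝ) : ℝ :=
  1 - 2 * stdNormalCDF (u * (1 - r t) /
      Real.sqrt (1 - r t ^ 2 + deriv r t ^ 2 / deriv (deriv r) 0))
    - 2 * (1 / Real.sqrt (-deriv (deriv r) 0)) * (deriv r t / Real.sqrt (1 - r t ^ 2))
        * Real.exp (-(u ^ 2 / 2) * (1 - r t) / (1 + r t))
        * stdNormalCDF ((-u / Real.sqrt (-deriv (deriv r) 0))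
            * Real.sqrt ((1 - r t) / (1 + r t)) * deriv r t
            / Real.sqrt (1 - r t ^ 2 + deriv r t ^ 2 / deriv (deriv r) 0))

theorem integrable_stdNormalCDF_density :
    Integrable (fun z : ℝ => (Real.sqrt (2 * Real.pi))⁻¹ * Real.exp (-z ^ 2 / 2)) := by
  refine Integrable.const_mul ?_ _
  convert integrable_exp_neg_mul_sq (b := 1 / 2) (by norm_num) using 3
  ring

theorem abs_stdNormalCDF_le (x : ℝ) :
    |stdNormalCDF x| ≤ ∫ z : ℝ, (Real.sqrt (2 * Real.pi))⁻¹ * Real.exp (-z ^ 2 / 2) := by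
  have h : ∀ z : ℝ, 0 ≤ (Real.sqrt (2 * Real.pi))⁻¹ * Real.exp (-z ^ 2 / 2) :=
    fun z => by positivity
  rw [stdNormalCDF, abs_of_nonneg (integral_nonneg h)]
  exact setIntegral_le_integral integrable_stdNormalCDF_density (Eventually.of_forall h)

/-- Rescaling the argument by a factor near `1` changes the normal distribution function by a small
amount, uniformly in the argument. -/
theorem abs_stdNormalCDF_mul_sub_le {k : ℝ} (hk : 1 / 2 ≤ k) (a : ℝ) :
    |stdNormalCDF (k * a) - stdNormalCDF a| ≤ 2 * |k - 1| := by
  have hpi : (Real.sqrt (2 * Real.pi))⁻¹ ≤ 1 :=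
    inv_le_one_of_one_le₀ (Real.one_le_sqrt.2 (by linarith [Real.pi_gt_three]))
  have hbound : ∀ z ∈ Set.uIoc a (k * a),
      ‖(Real.sqrt (2 * Real.pi))⁻¹ * Real.exp (-z ^ 2 / 2)‖ ≤ Real.exp (-(a ^ 2 / 8)) := by
    intro z hz
    have hsq : a ^ 2 / 4 ≤ z ^ 2 := by
      rcases Set.mem_uIoc.1 hz with ⟨h1, h2⟩ | ⟨h1, h2⟩
      · rcases le_total 0 a with ha | ha
        · nlinarith
        · have : k * a ≤ a / 2 := by nlinarith
          nlinarith
      · rcases le_total 0 a with ha | ha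
        · have : a / 2 ≤ k * a := by nlinarith
          nlinarith
        · nlinarith
    rw [Real.norm_of_nonneg (by positivity)]
    calc _ ≤ 1 * Real.exp (-z ^ 2 / 2) := by gcongr
      _ ≤ _ := by rw [one_mul]; exact Real.exp_le_exp.2 (by linarith)
  have hexp : Real.exp (-(a ^ 2 / 8)) * |a| ≤ 2 := by
    rw [Real.exp_neg, inv_mul_le_iff₀ (Real.exp_pos _)]
    nlinarith [Real.add_one_le_exp (a ^ 2 / 8), sq_abs a, sq_nonneg (|a| - 2)]
  rw [stdNormalCDF, stdNormalCDF, intervalIntegral.integral_Iic_sub_Iic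
    integrable_stdNormalCDF_density.integrableOn integrable_stdNormalCDF_density.integrableOn,
    ← Real.norm_eq_abs]
  refine (intervalIntegral.norm_integral_le_of_norm_le_const hbound).trans ?_
  rw [show k * a - a = a * (k - 1) by ring, abs_mul, ← mul_assoc]
  gcongr

theorem tendsto_one_sub_sq_div_sq {r : ℝ → ℝ} (hr : ContDiff ℝ 2 r) (hr0 : r 0 = 1)
    (hslope : Tendsto (fun t => deriv r t / t) (nhdsWithin 0 (Set.Ioi 0))
      (nhds (deriv (deriv r) 0))) :
    Tendsto (fun t => (1 - r t ^ 2) / t ^ 2) (nhdsWithin 0 (Set.Ioi 0))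
      (nhds (-deriv (deriv r) 0)) := by
  have hrt : Tendsto r (nhdsWithin 0 (Set.Ioi 0)) (nhds 1) :=
    hr0 ▸ (hr.continuous.tendsto 0).mono_left nhdsWithin_le_nhds
  refine HasDerivAt.lhopital_zero_nhdsGT (f' := fun t => -(2 * r t * deriv r t))
    (g' := fun t => 2 * t) (Eventually.of_forall fun t => ?_) (Eventually.of_forall fun t => ?_)
    ?_ ?_ ?_ ?_
  · have h := ((hr.differentiable (by norm_num) t).hasDerivAt.pow 2).const_sub 1
    simpa using h
  · simpa using hasDerivAt_pow 2 t
  · filter_upwards [self_mem_nhdsWithin] with t ht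
    exact mul_ne_zero two_ne_zero (ne_of_gt ht)
  · simpa using (hrt.pow 2).const_sub 1
  · have h : Tendsto (fun t : ℝ => t ^ 2) (nhds 0) (nhds 0) := by
      simpa using (continuous_pow 2).tendsto (0 : ℝ)
    exact h.mono_left nhdsWithin_le_nhds
  · have h := (hrt.mul hslope).neg
    rw [one_mul] at h
    refine h.congr' ?_
    filter_upwards [self_mem_nhdsWithin] with t ht
    have ht' : t ≠ 0 := ne_of_gt ht
    field_simp

theorem tendsto_normalized_deriv {r : ℝ → ℝ} (hr : ContDiff ℝ 2 r) (hr0 : r 0 = 1)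
    (hr'0 : deriv r 0 = 0) (hr''0 : deriv (deriv r) 0 < 0) :
    Tendsto (fun t => 1 / Real.sqrt (-deriv (deriv r) 0) * (deriv r t / Real.sqrt (1 - r t ^ 2)))
      (nhdsWithin 0 (Set.Ioi 0)) (nhds (-1)) := by
  have hd : HasDerivAt (deriv r) (deriv (deriv r) 0) 0 := by
    have h : ContDiff ℝ 1 (deriv r) := ((contDiff_succ_iff_deriv (n := 1)).1 hr).2.2
    exact (h.differentiable (by norm_num) 0).hasDerivAt
  have hslope : Tendsto (fun t => deriv r t / t) (nhdsWithin 0 (Set.Ioi 0))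
      (nhds (deriv (deriv r) 0)) := by
    refine ((hasDerivAt_iff_tendsto_slope.1 hd).mono_left
      (nhdsWithin_mono _ fun t ht => ne_of_gt ht)).congr fun t => ?_
    simp [slope_def_field, hr'0]
  have hs : 0 < -deriv (deriv r) 0 := by linarith
  have hs' : 0 < Real.sqrt (-deriv (deriv r) 0) := Real.sqrt_pos.2 hs
  have h := (hslope.div (tendsto_one_sub_sq_div_sq hr hr0 hslope).sqrt hs'.ne').const_mul
    (1 / Real.sqrt (-deriv (deriv r) 0))
  have hval : 1 / Real.sqrt (-deriv (deriv r) 0) *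
      (deriv (deriv r) 0 / Real.sqrt (-deriv (deriv r) 0)) = -1 := by
    rw [div_mul_div_comm, one_mul, Real.mul_self_sqrt hs.le, div_neg, div_self hr''0.ne]
  rw [hval] at h
  refine h.congr' ?_
  filter_upwards [self_mem_nhdsWithin] with t ht
  have ht' : 0 < t := ht
  simp only [Pi.div_apply]
  rw [Real.sqrt_div' _ (sq_nonneg t), Real.sqrt_sq ht'.le, div_div_div_cancel_right₀ ht'.ne']

theorem sqrt_one_sub_div_one_add_s5 {x : ℝ} (h1 : -1 < x) (h2 : x < 1) :
    Real.sqrt ((1 - x) / (1 + x)) = (1 - x) / Real.sqrt (1 - x ^ 2) := by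
  have hx : 0 < 1 - x := by linarith
  have hx' : 0 < 1 + x := by linarith
  rw [show (1 - x) / (1 + x) = (1 - x) ^ 2 / (1 - x ^ 2) by
    rw [show 1 - x ^ 2 = (1 - x) * (1 + x) by ring]; field_simp,
    Real.sqrt_div (sq_nonneg _), Real.sqrt_sq hx.le]

theorem stmt_5 (r : ℝ → ℝ) (hr : ContDiff ℝ 2 r)
    (hr0 : r 0 = 1) (hr'0 : deriv r 0 = 0) (hr''0 : deriv (deriv r) 0 < 0)
    (hε : ∃ ε > 0, ∀ t : ℝ, 0 < t → t < ε →
      (-1 < r t ∧ r t < 1) ∧ 0 < 1 - r t ^ 2 + deriv r t ^ 2 / deriv (deriv r) 0)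
    (u : ℝ) :
    Tendsto (fun t => EuPlus r u t) (nhdsWithin 0 (Set.Ioi 0)) (nhds 1) := by
  obtain ⟨ε, hε0, hε⟩ := hε
  set k : ℝ → ℝ := fun t =>
    -(1 / Real.sqrt (-deriv (deriv r) 0) * (deriv r t / Real.sqrt (1 - r t ^ 2))) with hk
  set a : ℝ → ℝ := fun t => u * (1 - r t) /
    Real.sqrt (1 - r t ^ 2 + deriv r t ^ 2 / deriv (deriv r) 0) with ha
  set e : ℝ → ℝ := fun t => Real.exp (-(u ^ 2 / 2) * (1 - r t) / (1 + r t)) with he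
  have hkt : Tendsto k (nhdsWithin 0 (Set.Ioi 0)) (nhds 1) := by
    simpa [hk] using (tendsto_normalized_deriv hr hr0 hr'0 hr''0).neg
  have het : Tendsto e (nhdsWithin 0 (Set.Ioi 0)) (nhds 1) := by
    have hrt : Tendsto r (nhdsWithin 0 (Set.Ioi 0)) (nhds 1) :=
      hr0 ▸ (hr.continuous.tendsto 0).mono_left nhdsWithin_le_nhds
    have h := (((hrt.const_sub 1).const_mul (-(u ^ 2 / 2))).div (hrt.const_add 1)
      (by norm_num)).rexp
    simpa [he] using h
  have hdiff : Tendsto (fun t => stdNormalCDF (k t * a t) - stdNormalCDF (a t))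
      (nhdsWithin 0 (Set.Ioi 0)) (nhds 0) := by
    have hlim : Tendsto (fun t => 2 * |k t - 1|) (nhdsWithin 0 (Set.Ioi 0)) (nhds 0) := by
      simpa using (hkt.sub_const 1).abs.const_mul 2
    refine squeeze_zero_norm' ?_ hlim
    filter_upwards [hkt.eventually_const_le (by norm_num : (1 / 2 : ℝ) < 1)] with t ht
    exact abs_stdNormalCDF_mul_sub_le ht _
  have hprod : Tendsto (fun t => (k t * e t - 1) * stdNormalCDF (k t * a t))
      (nhdsWithin 0 (Set.Ioi 0)) (nhds 0) := by
    have hlim : Tendsto (fun t => k t * e t - 1) (nhdsWithin 0 (Set.Ioi 0)) (nhds 0) := by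
      simpa using (hkt.mul het).sub_const 1
    exact hlim.zero_mul_isBoundedUnder_le
      (isBoundedUnder_of ⟨_, fun t => abs_stdNormalCDF_le (k t * a t)⟩)
  have hsum := ((hdiff.add hprod).const_mul 2).const_add 1
  rw [add_zero, mul_zero, add_zero] at hsum
  refine hsum.congr' ?_
  filter_upwards [Ioo_mem_nhdsGT hε0] with t ht
  obtain ⟨⟨h1, h2⟩, -⟩ := hε t ht.1 ht.2
  have hb : (-u / Real.sqrt (-deriv (deriv r) 0)) * Real.sqrt ((1 - r t) / (1 + r t)) * deriv r t /
      Real.sqrt (1 - r t ^ 2 + deriv r t ^ 2 / deriv (deriv r) 0) = k t * a t := by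
    rw [sqrt_one_sub_div_one_add_s5 h1 h2]
    simp only [hk, ha]
    ring
  rw [EuPlus, hb]
  simp only [hk, ha, he]
  ring
end

section
/- Let (X, Y) be jointly Gaussian real random variables, each centered with variance 1, and with correlation ρ ∈ [−1, 1]. Then E[sgn(X) · sgn(Y)] = (2/π) · arcsin(ρ); equivalently, the covariance of the zero-level clipped process satisfies Cov(sgn X, sgn Y) = (2/π) arcsin ρ. -/
open MeasureTheory ProbabilityTheory Real

lemma gaussianPDF_mul_gaussianPDF_polar (r θ : ℝ) :
    gaussianPDFReal 0 1 (r * cos θ) * gaussianPDFReal 0 1 (r * sin θ) =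
      gaussianPDFReal 0 1 r * gaussianPDFReal 0 1 0 := by
  simp only [gaussianPDFReal, NNReal.coe_one]
  rw [mul_mul_mul_comm, mul_mul_mul_comm _ (rexp (-(r - 0) ^ 2 / (2 * 1))),
    ← exp_add, ← exp_add]
  congr 2
  linear_combination (-r ^ 2 / 2) * cos_sq_add_sin_sq θ

lemma integral_stdGaussian_prod (f : ℝ × ℝ → ℝ) :
    ∫ p, f p ∂((gaussianReal 0 1).prod (gaussianReal 0 1)) =
      ∫ p : ℝ × ℝ, gaussianPDFReal 0 1 p.1 * gaussianPDFReal 0 1 p.2 * f p := by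
  rw [gaussianReal_of_var_ne_zero _ one_ne_zero,
    prod_withDensity (measurable_gaussianPDF _ _) (measurable_gaussianPDF _ _),
    integral_withDensity_eq_integral_toReal_smul (by fun_prop)
      (ae_of_all _ fun _ ↦ ENNReal.mul_lt_top gaussianPDF_lt_top gaussianPDF_lt_top)]
  simp [toReal_gaussianPDF, Measure.volume_eq_prod]

lemma integral_stdGaussian_prod_eq_const_mul (f : ℝ × ℝ → ℝ)
    (hf : ∀ r θ : ℝ, 0 < r → f (r * cos θ, r * sin θ) = f (cos θ, sin θ)) :
    ∫ p, f p ∂((gaussianReal 0 1).prod (gaussianReal 0 1)) =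
      (∫ r in Set.Ioi (0 : ℝ), r * (gaussianPDFReal 0 1 r * gaussianPDFReal 0 1 0)) *
        ∫ θ in (-π)..π, f (cos θ, sin θ) := by
  rw [integral_stdGaussian_prod, ← integral_comp_polarCoord_symm,
    intervalIntegral.integral_of_le (by linarith [pi_pos]), integral_Ioc_eq_integral_Ioo,
    ← setIntegral_prod_mul, ← Measure.volume_eq_prod]
  refine setIntegral_congr_fun (measurableSet_Ioi.prod measurableSet_Ioo) fun p hp ↦ ?_
  simp only [polarCoord_symm_apply, smul_eq_mul, gaussianPDF_mul_gaussianPDF_polar,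
    hf p.1 p.2 hp.1]
  ring

/-- The direction of a standard Gaussian vector of the plane is uniform on the circle. -/
lemma integral_stdGaussian_prod_eq_intervalIntegral (f : ℝ × ℝ → ℝ)
    (hf : ∀ r θ : ℝ, 0 < r → f (r * cos θ, r * sin θ) = f (cos θ, sin θ)) :
    ∫ p, f p ∂((gaussianReal 0 1).prod (gaussianReal 0 1)) =
      (2 * π)⁻¹ * ∫ θ in (-π)..π, f (cos θ, sin θ) := by
  have h := integral_stdGaussian_prod_eq_const_mul (fun _ ↦ 1) fun _ _ _ ↦ rfl
  simp only [integral_const, probReal_univ, intervalIntegral.integral_const, smul_eq_mul,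
    mul_one] at h
  rw [integral_stdGaussian_prod_eq_const_mul f hf]
  congr 1
  exact eq_inv_of_mul_eq_one_left (by linear_combination -h)

lemma measurable_real_sign : Measurable Real.sign :=
  Measurable.ite measurableSet_Iio measurable_const
    (Measurable.ite measurableSet_Ioi measurable_const measurable_const)

lemma real_sign_mul_of_pos {r : ℝ} (hr : 0 < r) (x : ℝ) : Real.sign (r * x) = Real.sign x := by
  rcases lt_trichotomy x 0 with hx | rfl | hx
  · rw [sign_of_neg hx, sign_of_neg (mul_neg_of_pos_of_neg hr hx)]
  · simp
  · rw [sign_of_pos hx, sign_of_pos (mul_pos hr hx)]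

lemma intervalIntegral_eq_of_forall_Ioo {f : ℝ → ℝ} {a b c : ℝ} (hab : a ≤ b)
    (h : ∀ x ∈ Set.Ioo a b, f x = c) :
    IntervalIntegrable f volume a b ∧ ∫ x in a..b, f x = (b - a) * c := by
  constructor
  · rw [intervalIntegrable_iff_integrableOn_Ioo_of_le hab]
    exact (integrableOn_const (by simp)).congr_fun (fun x hx ↦ (h x hx).symm) measurableSet_Ioo
  · rw [intervalIntegral.integral_of_le hab, integral_Ioc_eq_integral_Ioo,
      setIntegral_congr_fun measurableSet_Ioo h]
    simp [hab]

lemma integral_sign_cos_mul_sign_cos_sub {α : ℝ} (h0 : 0 ≤ α) (hπ : α ≤ π) :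
    ∫ θ in (-π)..π, Real.sign (cos θ) * Real.sign (cos (θ - α)) = 2 * (π - 2 * α) := by
  set g : ℝ → ℝ := fun θ ↦ Real.sign (cos θ) * Real.sign (cos (θ - α)) with hg
  have hper : Function.Periodic g π := fun θ ↦ by
    simp only [hg, add_sub_right_comm, cos_add_pi, Real.sign_neg, neg_mul_neg]
  have hcos : ∀ θ ∈ Set.Ioo (-(π / 2)) (π / 2), Real.sign (cos θ) = 1 := fun θ hθ ↦
    sign_of_pos (cos_pos_of_mem_Ioo hθ)
  obtain ⟨hi₁, h₁⟩ := intervalIntegral_eq_of_forall_Ioo (f := g) (c := -1)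
    (a := -(π / 2)) (b := -(π / 2) + α) (by linarith) fun θ hθ ↦ by
      rw [hg]
      dsimp only
      rw [hcos θ ⟨hθ.1, by linarith [hθ.2]⟩, one_mul, ← cos_neg]
      exact sign_of_neg (cos_neg_of_pi_div_two_lt_of_lt (by linarith [hθ.2])
        (by linarith [hθ.1]))
  obtain ⟨hi₂, h₂⟩ := intervalIntegral_eq_of_forall_Ioo (f := g) (c := 1)
    (a := -(π / 2) + α) (b := π / 2) (by linarith) fun θ hθ ↦ by
      rw [hg]
      dsimp only
      rw [hcos θ ⟨by linarith [hθ.1], hθ.2⟩, one_mul,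
        hcos _ ⟨by linarith [hθ.1], by linarith [hθ.2]⟩]
  have hhalf (a : ℝ) : ∫ θ in a..a + π, g θ = π - 2 * α := by
    rw [hper.intervalIntegral_add_eq a (-(π / 2)), show -(π / 2) + π = π / 2 by ring,
      ← intervalIntegral.integral_add_adjacent_intervals hi₁ hi₂, h₁, h₂]
    ring
  have hint (a : ℝ) : IntervalIntegrable g volume a (a + π) :=
    hper.intervalIntegrable pi_ne_zero (t := -(π / 2))
      (by rw [show -(π / 2) + π = π / 2 by ring]; exact hi₁.trans hi₂) _ _
  have e₁ := hhalf (-π)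
  have e₂ := hhalf 0
  have i₁ := hint (-π)
  have i₂ := hint 0
  rw [neg_add_cancel] at e₁ i₁
  rw [zero_add] at e₂ i₂
  rw [← intervalIntegral.integral_add_adjacent_intervals i₁ i₂, e₁, e₂]
  ring

lemma integral_sign_gaussianReal : ∫ x, Real.sign x ∂(gaussianReal 0 1) = 0 := by
  have h : ∫ x, Real.sign x ∂((gaussianReal 0 1).map fun x ↦ -x) =
      ∫ x, Real.sign (-x) ∂(gaussianReal 0 1) :=
    integral_map (by fun_prop) measurable_real_sign.aestronglyMeasurable
  rw [gaussianReal_map_neg, neg_zero] at h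
  simp only [Real.sign_neg, integral_neg] at h
  linarith

lemma integral_sign_mul_sign_stdGaussian_prod {ρ : ℝ} (hρ : ρ ∈ Set.Icc (-1 : ℝ) 1) :
    ∫ p : ℝ × ℝ, Real.sign p.1 * Real.sign (ρ * p.1 + √(1 - ρ ^ 2) * p.2)
      ∂((gaussianReal 0 1).prod (gaussianReal 0 1)) = 2 / π * arcsin ρ := by
  rw [integral_stdGaussian_prod_eq_intervalIntegral]
  · have h (θ : ℝ) : ρ * cos θ + √(1 - ρ ^ 2) * sin θ = cos (θ - arccos ρ) := by
      rw [cos_sub, cos_arccos hρ.1 hρ.2, sin_arccos]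
      ring
    simp only [h]
    rw [integral_sign_cos_mul_sign_cos_sub (arccos_nonneg ρ) (arccos_le_pi ρ),
      arccos_eq_pi_div_two_sub_arcsin]
    field_simp
    ring
  · intro r θ hr
    simp only
    rw [← real_sign_mul_of_pos hr (cos θ), ← real_sign_mul_of_pos hr (ρ * cos θ + _)]
    ring_nf

theorem stmt_8 {Ω : Type*} [MeasureSpace Ω] [IsProbabilityMeasure (ℙ : Measure Ω)]
    (Z Y' : Ω → ℝ) (hZmeas : Measurable Z) (hY'meas : Measurable Y')
    (hInd : IndepFun Z Y' ℙ)
    (hZ : Measure.map Z ℙ = gaussianReal 0 1)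
    (hY' : Measure.map Y' ℙ = gaussianReal 0 1)
    (ρ : ℝ) (hρ : ρ ∈ Set.Icc (-1 : ℝ) 1)
    (X Y : Ω → ℝ) (hX : X = Z) (hY : Y = fun ω => ρ * Z ω + Real.sqrt (1 - ρ ^ 2) * Y' ω) :
    ∫ ω, Real.sign (X ω) * Real.sign (Y ω) ∂ℙ = (2 / Real.pi) * Real.arcsin ρ ∧
    (∫ ω, Real.sign (X ω) * Real.sign (Y ω) ∂ℙ)
        - (∫ ω, Real.sign (X ω) ∂ℙ) * (∫ ω, Real.sign (Y ω) ∂ℙ) =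
      (2 / Real.pi) * Real.arcsin ρ := by
  have hcov : ∫ ω, Real.sign (X ω) * Real.sign (Y ω) ∂ℙ = (2 / Real.pi) * Real.arcsin ρ := by
    have hmap := hInd.map_prod_eq_prod_map_map hZmeas.aemeasurable hY'meas.aemeasurable
    rw [hZ, hY'] at hmap
    have hmeas : Measurable fun p : ℝ × ℝ ↦
        Real.sign p.1 * Real.sign (ρ * p.1 + √(1 - ρ ^ 2) * p.2) :=
      (measurable_real_sign.comp measurable_fst).mul
        (measurable_real_sign.comp (by fun_prop))
    rw [← integral_sign_mul_sign_stdGaussian_prod hρ, ← hmap,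
      integral_map (by fun_prop) hmeas.aestronglyMeasurable, hX, hY]
  have hmean : ∫ ω, Real.sign (X ω) ∂ℙ = 0 := by
    rw [hX, ← integral_map (φ := Z) hZmeas.aemeasurable
      measurable_real_sign.aestronglyMeasurable, hZ, integral_sign_gaussianReal]
  exact ⟨hcov, by rw [hcov, hmean, zero_mul, sub_zero]⟩
end
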